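/- Let g ⊆ so(V) be a Lie subalgebra with n = dim V > 4. If the space {F ∈ g^⊥ : [F, g^⊥] ⊆ g} is nonzero, then [g^⊥, g^⊥] ⊆ g and the brackets [A,B] with A,B ∈ g^⊥ span g; in particular g is a symmetric Lie subalgebra of so(V) with [g^⊥, g^⊥] = g. -/

import Mathlib

open scoped RealInnerProductSpace BigOperators

noncomputable section

variable {V : Type} [NormedAddCommGroup V] [InnerProductSpace ℝ V] [FiniteDimensional ℝ V]

/-- A skew-symmetric endomorphism of a real inner product space. -/
def IsSkew (A : V →ₗ[ℝ] V) : Prop := ∀ x y : V, ⟪A x, y⟫ = - ⟪x, A y⟫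

/-- The inner product on `Λ²V ≅ so(V)` for which `{eᵢ∧eⱼ : i<j}` is orthonormal,
computed in the standard orthonormal basis of `V`. -/
def formInner (F G : V → V) : ℝ :=
  ∑ i, ∑ j ∈ Finset.Ioi i,
    ⟪F (stdOrthonormalBasis ℝ V i), stdOrthonormalBasis ℝ V j⟫ *
      ⟪G (stdOrthonormalBasis ℝ V i), stdOrthonormalBasis ℝ V j⟫

/-- Membership in `g^⊥`, the orthogonal complement of `g` in `Λ²V ≅ so(V)`. -/
def InPerp (g : Submodule ℝ (V →ₗ[ℝ] V)) (F : V →ₗ[ℝ] V) : Prop :=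
  IsSkew F ∧ ∀ A ∈ g, formInner (⇑F) (⇑A) = 0

set_option linter.unusedSectionVars false

theorem lA (A B C : Module.End ℝ V) : ⁅A + B, C⁆ = ⁅A, C⁆ + ⁅B, C⁆ := by
  simp only [Ring.lie_def]; noncomm_ring
theorem lA' (A B C : Module.End ℝ V) : ⁅A, B + C⁆ = ⁅A, B⁆ + ⁅A, C⁆ := by
  simp only [Ring.lie_def]; noncomm_ring
theorem lS (c : ℝ) (A B : Module.End ℝ V) : ⁅c • A, B⁆ = c • ⁅A, B⁆ := by
  simp only [Ring.lie_def, smul_mul_assoc, mul_smul_comm, smul_sub]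
theorem lS' (c : ℝ) (A B : Module.End ℝ V) : ⁅A, c • B⁆ = c • ⁅A, B⁆ := by
  simp only [Ring.lie_def, smul_mul_assoc, mul_smul_comm, smul_sub]
theorem lN (A B : Module.End ℝ V) : -⁅B, A⁆ = ⁅A, B⁆ := by
  simp only [Ring.lie_def]; noncomm_ring
theorem lL (A B C : Module.End ℝ V) : ⁅⁅A, B⁆, C⁆ = ⁅A, ⁅B, C⁆⁆ - ⁅B, ⁅A, C⁆⁆ := by
  simp only [Ring.lie_def]; noncomm_ring
theorem lJ (A B C : Module.End ℝ V) : ⁅A, ⁅B, C⁆⁆ = ⁅⁅A, B⁆, C⁆ + ⁅B, ⁅A, C⁆⁆ := by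
  simp only [Ring.lie_def]; noncomm_ring
theorem l0 (A : Module.End ℝ V) : ⁅A, (0 : Module.End ℝ V)⁆ = 0 := by
  simp [Ring.lie_def]
theorem l0' (A : Module.End ℝ V) : ⁅(0 : Module.End ℝ V), A⁆ = 0 := by
  simp [Ring.lie_def]

def wd (u v : V) : Module.End ℝ V :=
  (innerₛₗ ℝ u).smulRight v - (innerₛₗ ℝ v).smulRight u

theorem wd_apply (u v x : V) : wd u v x = ⟪u, x⟫ • v - ⟪v, x⟫ • u := by
  simp [wd]

theorem wd_skew (u v : V) : IsSkew (wd u v) := by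
  intro x y
  simp only [wd_apply, inner_sub_left, inner_sub_right, inner_smul_left, inner_smul_right]
  simp [real_inner_comm]
  ring

theorem skew_lie {A B : Module.End ℝ V} (hA : IsSkew A) (hB : IsSkew B) : IsSkew ⁅A, B⁆ := by
  intro x y
  simp only [Ring.lie_def, LinearMap.sub_apply, Module.End.mul_apply, inner_sub_left,
    inner_sub_right, hA _ _, hB _ _]
  ring

theorem lie_wd {A : Module.End ℝ V} (hA : IsSkew A) (u v : V) :
    ⁅A, wd u v⁆ = wd (A u) v + wd u (A v) := by
  ext x
  have h1 := hA u x
  have h2 := hA v x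
  simp only [Ring.lie_def, LinearMap.sub_apply, Module.End.mul_apply, LinearMap.add_apply,
    wd_apply, map_sub, map_smul, h1, h2]
  module

theorem skew_self {A : Module.End ℝ V} (hA : IsSkew A) (x : V) : ⟪A x, x⟫ = 0 := by
  have := hA x x
  rw [real_inner_comm] at this
  rw [real_inner_comm]
  linarith

theorem mask_entry {ι : Type} [Fintype ι] [DecidableEq ι] (e : OrthonormalBasis ι ℝ V)
    {A : Module.End ℝ V} (hA : IsSkew A) {a b : ι} (hab : a ≠ b) (i j : ι) :
    ⟪⁅wd (e a) (e b), ⁅wd (e a) (e b), A⁆⁆ (e i), e j⟫ =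
      if ((i = a ∨ i = b) ↔ (j = a ∨ j = b)) then 0 else - ⟪A (e i), e j⟫ := by
  have hsk := wd_skew (e a) (e b)
  have key : ⟪⁅wd (e a) (e b), ⁅wd (e a) (e b), A⁆⁆ (e i), e j⟫ =
      ⟪A (e i), wd (e a) (e b) (wd (e a) (e b) (e j))⟫
      + 2 * ⟪A (wd (e a) (e b) (e i)), wd (e a) (e b) (e j)⟫
      + ⟪A (wd (e a) (e b) (wd (e a) (e b) (e i))), e j⟫ := by
    simp only [Ring.lie_def, LinearMap.sub_apply, Module.End.mul_apply, inner_sub_left,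
      map_sub, hsk _ (e j), hsk _ (wd (e a) (e b) (e j))]
    ring
  rw [key]
  have s1 := skew_self hA (e a)
  have s2 := skew_self hA (e b)
  have s3 := hA (e a) (e b)
  rw [real_inner_comm] at s3
  have Ea : wd (e a) (e b) (e a) = e b := by
    rw [wd_apply, e.inner_eq_ite, e.inner_eq_ite]; simp [hab.symm]
  have Eb : wd (e a) (e b) (e b) = - e a := by
    rw [wd_apply, e.inner_eq_ite, e.inner_eq_ite]; simp [hab]
  have Ek : ∀ k, k ≠ a → k ≠ b → wd (e a) (e b) (e k) = 0 := by
    intro k h1 h2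
    rw [wd_apply, e.inner_eq_ite, e.inner_eq_ite]; simp [h1.symm, h2.symm]
  generalize wd (e a) (e b) = E at *
  have hE0 : E 0 = 0 := map_zero E
  have hA0 : A 0 = 0 := map_zero A
  have hA2 : ∀ x, A (-x) = - A x := map_neg A
  have hE2 : ∀ x, E (-x) = - E x := map_neg E
  have cases3 : ∀ k, k = a ∨ k = b ∨ (k ≠ a ∧ k ≠ b) := by intro k; tauto
  rcases cases3 i with h | h | ⟨h, h'⟩ <;> rcases cases3 j with k | k | ⟨k, k'⟩
  · subst h; subst k
    rw [if_pos (by tauto), Ea, Eb, hA2, inner_neg_left, inner_neg_right, s1, s2]; simp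
  · subst h; subst k
    rw [if_pos (by tauto), Ea, Eb, hE2, hA2, Ea, inner_neg_left, inner_neg_right,
      inner_neg_right, hA (e j) (e i), real_inner_comm]; ring
  · subst h
    rw [if_neg (by tauto), Ek j k k', hE0, Ea, Eb, hA2, inner_neg_left]; simp
  · subst h; subst k
    rw [if_pos (by tauto), Ea, Eb, hE2, hA2, hA2, Ea, inner_neg_left, inner_neg_left,
      inner_neg_right, hA (e i) (e j), real_inner_comm]; ring
  · subst h; subst k
    rw [if_pos (by tauto), Eb, hE2, Ea, hA2, hA2, inner_neg_left, inner_neg_left, inner_neg_right,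
      inner_neg_right, s1, s2]; simp
  · subst h
    rw [if_neg (by tauto), Ek j k k', hE0, Eb, hE2, Ea, hA2, hA2, inner_neg_left]; simp
  · subst k
    rw [if_neg (by tauto), Ek i h h', hE0, Ea, Eb, hA0, inner_neg_right]; simp
  · subst k
    rw [if_neg (by tauto), Ek i h h', hE0, Eb, hE2, Ea, hA0, inner_neg_right]; simp
  · rw [if_pos (by tauto), Ek i h h', Ek j k k', hE0, hA0]; simp

theorem mask_mem {ι : Type} [Fintype ι] [DecidableEq ι] (e : OrthonormalBasis ι ℝ V)
    (I : Submodule ℝ (Module.End ℝ V)) (hI : ∀ X : Module.End ℝ V, IsSkew X → ∀ Y ∈ I, ⁅X, Y⁆ ∈ I)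
    {A : Module.End ℝ V} (hA : IsSkew A) (hAI : A ∈ I) {a b : ι} (hab : a ≠ b) :
    ∃ A' ∈ I, IsSkew A' ∧ ∀ i j, ⟪A' (e i), e j⟫ =
      if ((i = a ∨ i = b) ↔ (j = a ∨ j = b)) then 0 else ⟪A (e i), e j⟫ := by
  have hsk := wd_skew (e a) (e b)
  refine ⟨-⁅wd (e a) (e b), ⁅wd (e a) (e b), A⁆⁆, I.neg_mem (hI _ hsk _ (hI _ hsk _ hAI)), ?_, ?_⟩
  · have := skew_lie hsk (skew_lie hsk hA)
    intro x y
    simp [this x y]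
  · intro i j
    rw [LinearMap.neg_apply, inner_neg_left, mask_entry e hA hab]
    split_ifs <;> simp

theorem ext_basis {ι : Type} [Fintype ι] (e : OrthonormalBasis ι ℝ V)
    {A B : Module.End ℝ V} (h : ∀ i j, ⟪A (e i), e j⟫ = ⟪B (e i), e j⟫) : A = B := by
  apply e.toBasis.ext
  intro i
  refine InnerProductSpace.ext_inner_right_basis (𝕜 := ℝ) e.toBasis fun j => ?_
  simpa using h i j

theorem wd_smul_right (u v : V) (c : ℝ) : wd u (c • v) = c • wd u v := by
  ext x; simp only [wd_apply, LinearMap.smul_apply, inner_smul_left]; simp; module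
theorem wd_add_right (u v w : V) : wd u (v + w) = wd u v + wd u w := by
  ext x; simp only [wd_apply, LinearMap.add_apply, inner_add_left]; module
theorem wd_self (u : V) : wd u u = 0 := by
  ext x; simp [wd_apply]
theorem wd_swap (u v : V) : wd u v = - wd v u := by
  ext x; simp [wd_apply]

theorem all_wd (I : Submodule ℝ (Module.End ℝ V)) (hI : ∀ X : Module.End ℝ V, IsSkew X → ∀ Y ∈ I, ⁅X, Y⁆ ∈ I)
    {u v : V} (hu : ⟪u, u⟫ = 1) (hv : v ≠ 0) (huv : ⟪u, v⟫ = 0) (hm : wd u v ∈ I) (x y : V) :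
    wd x y ∈ I := by
  have hvv : ⟪v, v⟫ ≠ 0 := by simpa using hv
  have h1 : ∀ x, wd u x ∈ I := by
    intro x
    set c := ⟪v, x⟫ / ⟪v, v⟫ with hc
    have h := hI _ (wd_skew v (x - c • v - ⟪u, x⟫ • u)) _ hm
    rw [lie_wd (wd_skew _ _)] at h
    have e1 : ⟪v, u⟫ = 0 := by rw [real_inner_comm]; exact huv
    have e2 : ⟪x - c • v - ⟪u, x⟫ • u, u⟫ = 0 := by
      rw [inner_sub_left, inner_sub_left, real_inner_smul_left, real_inner_smul_left, e1, hu,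
        real_inner_comm u x]
      ring
    have e3 : ⟪x - c • v - ⟪u, x⟫ • u, v⟫ = 0 := by
      simp only [inner_sub_left, inner_smul_left, huv, hc]
      simp [real_inner_comm]
      field_simp
      simp
    have e4 : wd v (x - c • v - ⟪u, x⟫ • u) u = 0 := by
      rw [wd_apply, e1, e2]; simp
    have e5 : wd v (x - c • v - ⟪u, x⟫ • u) v = ⟪v, v⟫ • (x - c • v - ⟪u, x⟫ • u) := by
      rw [wd_apply, e3]; simp
    rw [e4, e5, wd_smul_right] at h
    have e6 : wd (0 : V) v = 0 := by ext z; simp [wd_apply]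
    rw [e6, zero_add] at h
    have h' := (I.smul_mem_iff hvv).1 h
    have hx : x = (x - c • v - ⟪u, x⟫ • u) + (c • v + ⟪u, x⟫ • u) := by module
    rw [hx, wd_add_right, wd_add_right, wd_smul_right, wd_smul_right u u, wd_self]
    simpa using I.add_mem h' (I.smul_mem c hm)
  have h := hI _ (wd_skew u x) _ (h1 y)
  rw [lie_wd (wd_skew _ _), wd_apply, wd_apply, hu] at h
  have : wd x y = (wd ((1:ℝ) • x - ⟪x, u⟫ • u) y + wd u (⟪u, y⟫ • x - ⟪x, y⟫ • u))
      + ⟪x, u⟫ • wd u y - ⟪u, y⟫ • wd u x := by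
    ext z
    simp only [wd_apply, LinearMap.add_apply, LinearMap.sub_apply, LinearMap.smul_apply,
      inner_sub_left, inner_smul_left]
    simp
    module
  rw [this]
  exact I.sub_mem (I.add_mem h (I.smul_mem _ (h1 y))) (I.smul_mem _ (h1 x))

theorem skew_simple (hn : 4 < Module.finrank ℝ V)
    (I : Submodule ℝ (Module.End ℝ V)) (hI : ∀ X : Module.End ℝ V, IsSkew X → ∀ Y ∈ I, ⁅X, Y⁆ ∈ I)
    {F : Module.End ℝ V} (hF : IsSkew F) (hFI : F ∈ I) (hF0 : F ≠ 0)
    {X : Module.End ℝ V} (hX : IsSkew X) : X ∈ I := by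
  set e := stdOrthonormalBasis ℝ V
  have hall : ∀ x y, wd x y ∈ I := by
    obtain ⟨p, q, hpq⟩ : ∃ p q, ⟪F (e p), e q⟫ ≠ 0 := by
      by_contra! h
      exact hF0 (ext_basis e fun i j => by simp [h i j])
    have hne : p ≠ q := by
      rintro rfl
      exact hpq (skew_self hF _)
    have ex : ∀ s : Finset (Fin (Module.finrank ℝ V)), s.card ≤ 4 → ∃ a, a ∉ s := by
      intro s hs
      by_contra! h
      have := Finset.eq_univ_of_forall h
      rw [this] at hs
      simp at hs
      omega
    obtain ⟨r, hr⟩ := ex {p, q} (Finset.card_le_two.trans (by norm_num))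
    obtain ⟨s, hs⟩ := ex {p, q, r} (Finset.card_le_three.trans (by norm_num))
    obtain ⟨t, ht⟩ := ex {p, q, r, s} Finset.card_le_four
    simp only [Finset.mem_insert, Finset.mem_singleton, not_or] at hr hs ht
    obtain ⟨A, hAI, hA, hAe⟩ := mask_mem e I hI hF hFI (a := p) (b := r) (Ne.symm hr.1)
    obtain ⟨B, hBI, hB, hBe⟩ := mask_mem e I hI hA hAI (a := p) (b := s) (Ne.symm hs.1)
    obtain ⟨C, hCI, hC, hCe⟩ := mask_mem e I hI hB hBI (a := p) (b := t) (Ne.symm ht.1)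
    have hzero : ∀ i j, i ≠ p → j ≠ p → ⟪C (e i), e j⟫ = 0 := by
      intro i j hi hj
      rw [hCe, hBe, hAe]
      grind
    have hCpq : ⟪C (e p), e q⟫ = ⟪F (e p), e q⟫ := by
      rw [hCe, hBe, hAe]
      grind
    have hv : C (e p) ≠ 0 := by
      intro h
      rw [h] at hCpq
      simp at hCpq
      exact hpq hCpq.symm
    have hpp : ⟪e p, C (e p)⟫ = 0 := by rw [real_inner_comm]; exact skew_self hC _
    have hu : ⟪e p, e p⟫ = (1:ℝ) := by simp
    have hCw : C = wd (e p) (C (e p)) := by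
      apply ext_basis e
      intro i j
      rw [wd_apply]
      simp only [inner_sub_left, inner_smul_left, e.inner_eq_ite]
      by_cases hi : i = p
      · subst hi
        by_cases hj : j = i
        · subst hj
          simp [skew_self hC]
        · simp [skew_self hC, Ne.symm hj]
      · by_cases hj : j = p
        · subst hj
          simp [hC (e i) (e j), real_inner_comm, Ne.symm hi]
        · simp [hzero i j hi hj, Ne.symm hi, Ne.symm hj]
    exact all_wd I hI hu hv hpp (hCw ▸ hCI)
  have hXs : X = (1/2 : ℝ) • ∑ i, wd (e i) (X (e i)) := by
    ext z
    simp only [LinearMap.smul_apply, LinearMap.sum_apply, wd_apply, Finset.sum_sub_distrib]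
    have h1 : ∑ i, ⟪e i, z⟫ • X (e i) = X z := by
      conv_rhs => rw [← e.sum_repr' z]
      simp [map_sum]
    have h2 : ∑ i, ⟪X (e i), z⟫ • e i = - X z := by
      conv_rhs => rw [← e.sum_repr' (X z)]
      simp [hX _ z]
    rw [h1, h2]
    module
  rw [hXs]
  exact I.smul_mem _ (I.sum_mem fun i _ => hall _ _)

abbrev tr (A : Module.End ℝ V) : ℝ := LinearMap.trace ℝ V A

theorem formInner_eq {F G : Module.End ℝ V} (hF : IsSkew F) (hG : IsSkew G) :
    formInner (⇑F) (⇑G) = -(1/2) * tr (F * G) := by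
  set e := stdOrthonormalBasis ℝ V with he
  have h1 : tr (F * G) = - ∑ i, ∑ j, ⟪F (e i), e j⟫ * ⟪G (e i), e j⟫ := by
    rw [tr, LinearMap.trace_eq_sum_inner _ e, ← Finset.sum_neg_distrib]
    refine Finset.sum_congr rfl fun i _ => ?_
    have := e.sum_inner_mul_inner (F (e i)) (G (e i))
    simp only [real_inner_comm _ (G (e i))] at this ⊢
    rw [this, hF, Module.End.mul_apply]
    ring
  have h2 : ∑ i, ∑ j, ⟪F (e i), e j⟫ * ⟪G (e i), e j⟫ = 2 * formInner (⇑F) (⇑G) := by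
    have h3 := Finset.sum_sum_Ioi_add_eq_sum_sum_off_diag
      (fun j i => ⟪F (e i), e j⟫ * ⟪G (e i), e j⟫)
    have h4 : ∀ i, ∑ j, ⟪F (e i), e j⟫ * ⟪G (e i), e j⟫ =
        ∑ j ∈ {i}ᶜ, ⟪F (e i), e j⟫ * ⟪G (e i), e j⟫ := by
      intro i
      rw [← Finset.sum_add_sum_compl {i}]
      simp [skew_self hF]
    simp only [h4]
    rw [← h3, formInner, Finset.mul_sum]
    refine Finset.sum_congr rfl fun i _ => ?_
    rw [Finset.mul_sum]
    refine Finset.sum_congr rfl fun j _ => ?_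
    rw [hF (e j) (e i), hG (e j) (e i), real_inner_comm _ (e j), real_inner_comm _ (e j)]
    ring
  rw [h1, h2]
  ring

theorem tr_self {F : Module.End ℝ V} (hF : IsSkew F) (h : tr (F * F) = 0) : F = 0 := by
  set e := stdOrthonormalBasis ℝ V with he
  have h1 : tr (F * F) = - ∑ i, ‖F (e i)‖ ^ 2 := by
    rw [tr, LinearMap.trace_eq_sum_inner _ e, ← Finset.sum_neg_distrib]
    refine Finset.sum_congr rfl fun i _ => ?_
    rw [Module.End.mul_apply, ← real_inner_self_eq_norm_sq, hF (e i), neg_neg]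
  rw [h1, neg_eq_zero, Finset.sum_eq_zero_iff_of_nonneg (fun i _ => by positivity)] at h
  apply e.toBasis.ext
  intro i
  simpa using h i (Finset.mem_univ i)

def trForm : LinearMap.BilinForm ℝ (Module.End ℝ V) :=
  LinearMap.mk₂ ℝ (fun A B => tr (A * B)) (by intros; simp [tr, add_mul])
    (by intros; simp [tr]) (by intros; simp [tr, mul_add]) (by intros; simp [tr])

theorem tr_comm (A B : Module.End ℝ V) : tr (A * B) = tr (B * A) := LinearMap.trace_mul_comm _ _ _

theorem trForm_apply (A B : Module.End ℝ V) : trForm A B = tr (A * B) := rfl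

theorem IsSkew.add {A B : Module.End ℝ V} (hA : IsSkew A) (hB : IsSkew B) : IsSkew (A + B) := by
  intro x y
  simp [inner_add_left, inner_add_right, hA x y, hB x y]; ring
theorem IsSkew.sub {A B : Module.End ℝ V} (hA : IsSkew A) (hB : IsSkew B) : IsSkew (A - B) := by
  intro x y
  simp [inner_sub_left, inner_sub_right, hA x y, hB x y]; ring
theorem IsSkew.smul {A : Module.End ℝ V} (c : ℝ) (hA : IsSkew A) : IsSkew (c • A) := by
  intro x y
  simp [inner_smul_left, inner_smul_right, hA x y]
theorem IsSkew.zero : IsSkew (0 : Module.End ℝ V) := by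
  intro x y; simp

theorem decomp (W : Submodule ℝ (Module.End ℝ V)) (hW : ∀ A ∈ W, IsSkew A)
    {X : Module.End ℝ V} (hX : IsSkew X) :
    ∃ w ∈ W, ∃ p : Module.End ℝ V, IsSkew p ∧ (∀ A ∈ W, tr (p * A) = 0) ∧ X = w + p := by
  have hsymm : (trForm (V := V)).IsSymm := ⟨fun A B => tr_comm A B⟩
  have hdis : Disjoint W (trForm.orthogonal W) := by
    rw [Submodule.disjoint_def]
    intro A hA hA'
    exact tr_self (hW A hA) (hA' A hA)
  have hc := (trForm (V := V)).isCompl_orthogonal_of_restrict_nondegenerate hsymm.isRefl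
    (LinearMap.BilinForm.nondegenerate_restrict_of_disjoint_orthogonal _ hsymm.isRefl hdis)
  have hx : X ∈ W ⊔ trForm.orthogonal W := by rw [hc.sup_eq_top]; trivial
  obtain ⟨w, hw, p, hp, rfl⟩ := Submodule.mem_sup.1 hx
  refine ⟨w, hw, p, ?_, fun A hA => ?_, rfl⟩
  · have := hX.sub (hW w hw)
    rwa [add_sub_cancel_left] at this
  · rw [tr_comm]; exact hp A hA

def Perp (g : Submodule ℝ (Module.End ℝ V)) (F : Module.End ℝ V) : Prop :=
  IsSkew F ∧ ∀ A ∈ g, tr (F * A) = 0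

theorem inPerp_iff {g : Submodule ℝ (Module.End ℝ V)} (hg : ∀ A ∈ g, IsSkew A)
    (F : Module.End ℝ V) : InPerp g F ↔ Perp g F := by
  refine and_congr_right fun hF => forall₂_congr fun A hA => ?_
  rw [formInner_eq hF (hg A hA)]
  simp

theorem Perp.add {g : Submodule ℝ (Module.End ℝ V)} {A B : Module.End ℝ V}
    (hA : Perp g A) (hB : Perp g B) : Perp g (A + B) :=
  ⟨hA.1.add hB.1, fun X hX => by
    have h1 := hA.2 X hX
    have h2 := hB.2 X hX
    simp only [tr] at *
    rw [add_mul, map_add, h1, h2, add_zero]⟩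
theorem Perp.smul {g : Submodule ℝ (Module.End ℝ V)} {A : Module.End ℝ V} (c : ℝ)
    (hA : Perp g A) : Perp g (c • A) :=
  ⟨hA.1.smul c, fun X hX => by
    have h1 := hA.2 X hX
    simp only [tr] at *
    rw [smul_mul_assoc, map_smul, h1, smul_zero]⟩
theorem Perp.sub {g : Submodule ℝ (Module.End ℝ V)} {A B : Module.End ℝ V}
    (hA : Perp g A) (hB : Perp g B) : Perp g (A - B) := by
  have := hA.add (hB.smul (-1))
  rwa [neg_one_smul, ← sub_eq_add_neg] at this

theorem tr_lie (A B C : Module.End ℝ V) : tr (⁅A, B⁆ * C) = tr (A * ⁅B, C⁆) := by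
  simp only [tr, Ring.lie_def, sub_mul, mul_sub, map_sub]
  rw [LinearMap.trace_mul_comm ℝ (B * A) C, ← mul_assoc, ← mul_assoc,
    ← mul_assoc, mul_assoc A C B, LinearMap.trace_mul_comm ℝ A (C * B)]

theorem perp_lie {g : Submodule ℝ (Module.End ℝ V)} (hg : ∀ A ∈ g, IsSkew A)
    (hl : ∀ A ∈ g, ∀ B ∈ g, ⁅A, B⁆ ∈ g) {X F : Module.End ℝ V} (hX : X ∈ g) (hF : Perp g F) :
    Perp g ⁅X, F⁆ := by
  refine ⟨skew_lie (hg X hX) hF.1, fun A hA => ?_⟩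
  have h := hF.2 _ (hl _ hX _ hA)
  rw [← tr_lie] at h
  rw [← lN, neg_mul]
  simp only [tr] at *
  rw [map_neg, h, neg_zero]

/-- The space of all `F` in the complement of `g` bracketing the complement into `g`. -/
def aSub (g : Submodule ℝ (Module.End ℝ V)) : Submodule ℝ (Module.End ℝ V) where
  carrier := {F | Perp g F ∧ ∀ G, Perp g G → ⁅F, G⁆ ∈ g}
  add_mem' := by
    rintro A B ⟨hA, hA'⟩ ⟨hB, hB'⟩
    refine ⟨hA.add hB, fun G hG => ?_⟩
    rw [lA]
    exact g.add_mem (hA' G hG) (hB' G hG)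
  zero_mem' := ⟨⟨IsSkew.zero, fun A _ => by simp [tr]⟩, fun G _ => by rw [l0']; exact g.zero_mem⟩
  smul_mem' := by
    rintro c A ⟨hA, hA'⟩
    refine ⟨hA.smul c, fun G hG => ?_⟩
    rw [lS]
    exact g.smul_mem c (hA' G hG)

def brSpan (P : Module.End ℝ V → Prop) : Submodule ℝ (Module.End ℝ V) :=
  Submodule.span ℝ {C | ∃ A B, P A ∧ P B ∧ C = ⁅A, B⁆}

theorem main_lie (g : Submodule ℝ (Module.End ℝ V)) (hg : ∀ A ∈ g, IsSkew A)
    (hl : ∀ A ∈ g, ∀ B ∈ g, ⁅A, B⁆ ∈ g) (hn : 4 < Module.finrank ℝ V)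
    {F : Module.End ℝ V} (hF0 : F ≠ 0) (hF : F ∈ aSub g) :
    (∀ A B, Perp g A → Perp g B → ⁅A, B⁆ ∈ g) ∧ brSpan (Perp g) = g := by
  have haskew : ∀ A ∈ aSub g, IsSkew A := fun A hA => hA.1.1
  have hga : ∀ X ∈ g, ∀ A ∈ aSub g, ⁅X, A⁆ ∈ aSub g := by
    rintro X hX A ⟨hA, hA'⟩
    refine ⟨perp_lie hg hl hX hA, fun G hG => ?_⟩
    rw [lL]
    exact g.sub_mem (hl _ hX _ (hA' G hG)) (hA' _ (perp_lie hg hl hX hG))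
  have haa : ∀ A ∈ aSub g, ∀ B ∈ aSub g, ⁅A, B⁆ ∈ g := fun A hA B hB => hA.2 B hB.1
  have hb0 : ∀ b, Perp g b → (∀ A ∈ aSub g, tr (b * A) = 0) → ∀ A ∈ aSub g, ⁅b, A⁆ = 0 := by
    intro b hb hb' A hA
    have h1 : ⁅b, A⁆ ∈ g := by
      rw [← lN]; exact g.neg_mem (hA.2 b hb)
    apply tr_self (hg _ h1)
    rw [tr_lie]
    apply hb'
    rw [← lN]
    exact (aSub g).neg_mem (hga _ h1 _ hA)
  set S := brSpan (fun A => A ∈ aSub g) with hS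
  have hSg : S ≤ g := by
    rw [hS, brSpan, Submodule.span_le]
    rintro _ ⟨A, B, hA, hB, rfl⟩
    exact haa A hA B hB
  have hSm : ∀ A ∈ aSub g, ∀ B ∈ aSub g, ⁅A, B⁆ ∈ S := fun A hA B hB =>
    Submodule.subset_span ⟨A, B, hA, hB, rfl⟩
  have hideal : ∀ X : Module.End ℝ V, IsSkew X → ∀ Y ∈ aSub g ⊔ S, ⁅X, Y⁆ ∈ aSub g ⊔ S := by
    intro X hX
    obtain ⟨x, hx, m, hm, hm', rfl⟩ := decomp g hg hX
    obtain ⟨a, ha, b, hb, hb', rfl⟩ := decomp (aSub g) haskew hm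
    have hbp : Perp g b := by
      have := Perp.sub (g := g) ⟨hm, hm'⟩ ha.1
      rwa [add_sub_cancel_left] at this
    have hb00 := hb0 b hbp hb'
    have hA : ∀ A ∈ aSub g, ⁅x + (a + b), A⁆ ∈ aSub g ⊔ S := by
      intro A hA
      rw [lA, lA, hb00 A hA, add_zero]
      exact Submodule.add_mem_sup (hga x hx A hA) (hSm a ha A hA)
    have hB : ∀ B ∈ S, ⁅x + (a + b), B⁆ ∈ aSub g ⊔ S := by
      intro B hB
      induction hB using Submodule.span_induction with
      | mem C hC =>
        obtain ⟨A, B, hA, hB, rfl⟩ := hC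
        rw [lA, lA]
        have h1 : ⁅x, ⁅A, B⁆⁆ ∈ S := by
          rw [lJ]
          exact S.add_mem (hSm _ (hga x hx A hA) _ hB) (hSm _ hA _ (hga x hx B hB))
        have h2 : ⁅a, ⁅A, B⁆⁆ ∈ aSub g := by
          rw [← lN]
          exact (aSub g).neg_mem (hga _ (haa A hA B hB) _ ha)
        have h3 : ⁅b, ⁅A, B⁆⁆ = 0 := by
          rw [lJ, hb00 A hA, hb00 B hB, l0, l0', add_zero]
        rw [h3, add_zero, add_comm]
        exact Submodule.add_mem_sup h2 h1
      | zero => rw [l0]; exact Submodule.zero_mem _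
      | add y z _ _ hy hz => rw [lA']; exact Submodule.add_mem _ hy hz
      | smul c y _ hy => rw [lS']; exact Submodule.smul_mem _ c hy
    intro Y hY
    obtain ⟨A, hAm, B, hBm, rfl⟩ := Submodule.mem_sup.1 hY
    rw [lA']
    exact Submodule.add_mem _ (hA A hAm) (hB B hBm)
  have hall : ∀ X : Module.End ℝ V, IsSkew X → X ∈ aSub g ⊔ S := fun X hX =>
    skew_simple hn _ hideal hF.1.1 (Submodule.mem_sup_left hF) hF0 hX
  have hzero : ∀ Z, Perp g Z → Z ∈ g → Z = 0 := fun Z hZ hZ' => tr_self hZ.1 (hZ.2 Z hZ')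
  have hma : ∀ G, Perp g G → G ∈ aSub g := by
    intro G hG
    obtain ⟨A, hA, B, hB, rfl⟩ := Submodule.mem_sup.1 (hall G hG.1)
    have hB0 : B = 0 := by
      have := hG.sub hA.1
      rw [add_sub_cancel_left] at this
      exact hzero B this (hSg hB)
    rw [hB0, add_zero]; exact hA
  have hPg : ∀ A B, Perp g A → Perp g B → ⁅A, B⁆ ∈ g := fun A B hA hB => (hma A hA).2 B hB
  refine ⟨hPg, le_antisymm ?_ ?_⟩
  · rw [brSpan, Submodule.span_le]
    rintro _ ⟨A, B, hA, hB, rfl⟩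
    exact hPg A B hA hB
  · intro X hX
    obtain ⟨A, hA, B, hB, rfl⟩ := Submodule.mem_sup.1 (hall X (hg X hX))
    have hA0 : A = 0 := by
      have := g.sub_mem hX (hSg hB)
      rw [add_sub_cancel_right] at this
      exact hzero A hA.1 this
    rw [hA0, zero_add]
    refine Submodule.span_mono ?_ hB
    rintro _ ⟨A, B, hA, hB, rfl⟩
    exact ⟨A, B, hA.1, hB.1, rfl⟩

theorem stmt_16
    (g : Submodule ℝ (V →ₗ[ℝ] V))
    (hgskew : ∀ A ∈ g, IsSkew A)
    (hglie : ∀ A ∈ g, ∀ B ∈ g, A ∘ₗ B - B ∘ₗ A ∈ g)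
    (hn : 4 < Module.finrank ℝ V)
    -- the space `{F ∈ g^⊥ : [F, g^⊥] ⊆ g}` is nonzero
    (hne : ∃ F : V →ₗ[ℝ] V, F ≠ 0 ∧ InPerp g F ∧
      ∀ G : V →ₗ[ℝ] V, InPerp g G → F ∘ₗ G - G ∘ₗ F ∈ g) :
    -- then `[g^⊥, g^⊥] ⊆ g` ...
    (∀ A B : V →ₗ[ℝ] V, InPerp g A → InPerp g B → A ∘ₗ B - B ∘ₗ A ∈ g) ∧
    -- ... and the brackets of elements of `g^⊥` span `g`: `[g^⊥, g^⊥] = g`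
    Submodule.span ℝ {C : V →ₗ[ℝ] V |
      ∃ A B : V →ₗ[ℝ] V, InPerp g A ∧ InPerp g B ∧ C = A ∘ₗ B - B ∘ₗ A} = g := by
  obtain ⟨F, hF0, hF, hFG⟩ := hne
  have hp := inPerp_iff (V := V) (g := g) hgskew
  have h := main_lie (V := V) g hgskew hglie hn hF0
    ⟨(hp F).1 hF, fun G hG => hFG G ((hp G).2 hG)⟩
  refine ⟨fun A B hA hB => h.1 A B ((hp A).1 hA) ((hp B).1 hB), ?_⟩
  refine Eq.trans ?_ h.2
  rw [brSpan]
  congr 1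
  ext C
  refine exists_congr fun A => exists_congr fun B => ?_
  rw [hp, hp]
  rfl
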